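/- Quantitative directional expansivity (Theorem A): For every integer d ≥ 1 and all reals δ > 0 and ε > 0 there exists a positive integer k₀ = k₀(d, δ, ε) such that the following holds. For every ergodic measure-preserving ℤ^d-action T on a probability space (X, μ) and every measurable set A ⊆ X with μ(A) ≥ δ, there exist a positive integer k ≤ k₀, a T^k-ergodic component ν of μ with ν(A) ≥ μ(A), and a primitive vector v ∈ ℤ^d such that ν(⋃_{n∈ℤ} (T^{nv})⁻¹ A) > 1 − ε. -/

import Mathlib

open MeasureTheory Filter
open scoped symmDiff

/-- A measure-preserving `ℤ^d`-action on `(X, μ)`: a family of measurable maps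
`(T v)_{v ∈ ℤ^d}` with `T 0 = id`, `T (v+w) = T v ∘ T w`, each preserving `μ`. -/
def IsMPAction {X : Type} [MeasurableSpace X] (d : ℕ)
    (T : (Fin d → ℤ) → X → X) (μ : Measure X) : Prop :=
  T 0 = id ∧ (∀ v w, T (v + w) = T v ∘ T w) ∧ ∀ v, MeasurePreserving (T v) μ μ

/-- The action is ergodic: every measurable set invariant (up to null sets) under
all the maps `T v` has measure `0` or `1`. -/
def IsErgodicAction {X : Type} [MeasurableSpace X] (d : ℕ)
    (T : (Fin d → ℤ) → X → X) (μ : Measure X) : Prop :=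
  IsMPAction d T μ ∧
    ∀ A : Set X, MeasurableSet A →
      (∀ v, μ ((T v ⁻¹' A) ∆ A) = 0) → μ A = 0 ∨ μ A = 1

/-- Ergodicity of the restricted `kℤ^d`-action `(T (k•v))_{v ∈ ℤ^d}` with respect to `ν`. -/
def SubActionErgodic {X : Type} [MeasurableSpace X] (d k : ℕ)
    (T : (Fin d → ℤ) → X → X) (ν : Measure X) : Prop :=
  ∀ B : Set X, MeasurableSet B →
    (∀ v : Fin d → ℤ, ν ((T ((k : ℤ) • v) ⁻¹' B) ∆ B) = 0) → ν B = 0 ∨ ν B = 1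

/-- A `T^k`-ergodic component of `μ`: a normalized restriction `ν = μ(· ∩ C)/μ(C)` to a
`kℤ^d`-invariant (mod null sets) set `C` of positive measure such that the restricted
`kℤ^d`-action is ergodic with respect to `ν`. -/
def IsErgodicComponent {X : Type} [MeasurableSpace X] (d k : ℕ)
    (T : (Fin d → ℤ) → X → X) (μ ν : Measure X) : Prop :=
  ∃ C : Set X, MeasurableSet C ∧ 0 < μ C ∧
    (∀ v : Fin d → ℤ, μ ((T ((k : ℤ) • v) ⁻¹' C) ∆ C) = 0) ∧
    ν = (μ C)⁻¹ • μ.restrict C ∧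
    SubActionErgodic d k T ν

/-- A vector `v ∈ ℤ^d` is primitive if the gcd of its components is `1`. -/
def IsPrimitiveVec {d : ℕ} (v : Fin d → ℤ) : Prop := Finset.univ.gcd v = 1

section HilbertSpace

variable {H : Type*} [NormedAddCommGroup H] [InnerProductSpace ℝ H]

open scoped InnerProductSpace

/-- A family of mutually compatible subspaces such that `g` is orthogonal to all
`(m + 1)`-fold intersections satisfies a Bessel inequality with constant `m`. -/
lemma sum_norm_sq_starProjection_le {ι : Type*} [DecidableEq ι] (K : ι → Submodule ℝ H)
    [∀ i, (K i).HasOrthogonalProjection]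
    (hK : ∀ i j x, x ∈ K j → (K i).starProjection x ∈ K j) (s : Finset ι) :
    ∀ (m : ℕ) (g : H),
      (∀ t ⊆ s, t.card = m + 1 → ∀ x, (∀ i ∈ t, x ∈ K i) → ⟪x, g⟫_ℝ = 0) →
      ∑ i ∈ s, ‖(K i).starProjection g‖ ^ 2 ≤ m * ‖g‖ ^ 2 := by
  induction s using Finset.induction_on with
  | empty => intro m g _; simp; positivity
  | insert a s ha ih =>
    intro m g hg
    set p := (K a).starProjection g with hp
    have hpa : p ∈ K a := (K a).starProjection_apply_mem g
    have horth : ∀ y ∈ K a, ⟪y, g - p⟫_ℝ = 0 := fun y hy => by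
      rw [real_inner_comm]; exact (K a).starProjection_inner_eq_zero g y hy
    have hsplit : ∀ i, ‖(K i).starProjection g‖ ^ 2 =
        ‖(K i).starProjection p‖ ^ 2 + ‖(K i).starProjection (g - p)‖ ^ 2 := by
      intro i
      have h1 : (K i).starProjection g
          = (K i).starProjection p + (K i).starProjection (g - p) := by
        rw [← map_add, add_sub_cancel]
      have h2 : ⟪(K i).starProjection p, (K i).starProjection (g - p)⟫_ℝ = 0 := by
        rw [← Submodule.inner_starProjection_left_eq_right]
        exact horth _ (hK _ _ _ (hK _ _ _ hpa))
      rw [h1, norm_add_sq_real, h2]; ring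
    have hpyth : ‖g‖ ^ 2 = ‖p‖ ^ 2 + ‖g - p‖ ^ 2 := by
      have h1 : g = p + (g - p) := by abel
      conv_lhs => rw [h1]
      rw [norm_add_sq_real, horth p hpa]; ring
    have h2 := ih m (g - p) (by
      intro t ht hcard x hx
      rw [inner_sub_right, hp, ← Submodule.inner_starProjection_left_eq_right,
        hg t (ht.trans (Finset.subset_insert _ _)) hcard x hx,
        hg t (ht.trans (Finset.subset_insert _ _)) hcard _ fun i hi => hK _ _ _ (hx i hi),
        sub_zero])
    rw [Finset.sum_insert ha, Finset.sum_congr rfl fun i _ => hsplit i,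
      Finset.sum_add_distrib]
    rcases m with _ | m
    · have hp0 : p = 0 := by
        rw [hp, ← inner_self_eq_zero (𝕜 := ℝ),
          ← Submodule.inner_starProjection_left_eq_right]
        exact hg {a} (by simp) (by simp) _ (by simp)
      rw [← hp, hp0]
      simpa [hp0] using h2
    · have h1 := ih m p (by
        intro t ht hcard x hx
        rw [hp, ← Submodule.inner_starProjection_left_eq_right]
        refine hg (insert a t) (Finset.insert_subset_insert _ ht) ?_ _ ?_
        · rw [Finset.card_insert_of_notMem fun h => ha (ht h), hcard]
        · intro i hi
          rcases Finset.mem_insert.1 hi with rfl | hi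
          · exact Submodule.starProjection_apply_mem _ _
          · exact hK _ _ _ (hx i hi))
      push_cast at h2 ⊢
      rw [hpyth]
      nlinarith

variable {G : Type*} (U : G → H →ₗᵢ[ℝ] H)

/-- The vectors fixed by all `U v` with `v ∈ S`. -/
def fixedSubmodule (S : Set G) : Submodule ℝ H where
  carrier := {x | ∀ v ∈ S, U v x = x}
  add_mem' ha hb v hv := by rw [map_add, ha v hv, hb v hv]
  zero_mem' v _ := map_zero _
  smul_mem' c x hx v hv := by rw [map_smul, hx v hv]

lemma mem_fixedSubmodule {S : Set G} {x : H} :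
    x ∈ fixedSubmodule U S ↔ ∀ v ∈ S, U v x = x := Iff.rfl

lemma isClosed_fixedSubmodule (S : Set G) :
    IsClosed (fixedSubmodule U S : Set H) := by
  have : (fixedSubmodule U S : Set H) = ⋂ v ∈ S, {x | U v x = x} := by
    ext x; simp [mem_fixedSubmodule]
  rw [this]
  exact isClosed_biInter fun v _ => isClosed_eq (U v).continuous continuous_id

instance [CompleteSpace H] (S : Set G) : (fixedSubmodule U S).HasOrthogonalProjection :=
  haveI : CompleteSpace (fixedSubmodule U S) :=
    (isClosed_fixedSubmodule U S).completeSpace_coe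
  inferInstance

variable [AddCommGroup G] {U}

lemma starProjection_mem_fixedSubmodule [CompleteSpace H] (hzero : ∀ x, U 0 x = x)
    (hadd : ∀ v w x, U (v + w) x = U v (U w x)) (S S' : Set G) {x : H}
    (hx : x ∈ fixedSubmodule U S') :
    (fixedSubmodule U S).starProjection x ∈ fixedSubmodule U S' := by
  intro v hv
  have hcomm : ∀ w y, U v (U w y) = U w (U v y) := fun w y => by
    rw [← hadd, add_comm, hadd]
  symm
  refine Submodule.eq_starProjection_of_mem_orthogonal ?_ ?_
  · intro w hw
    rw [← hcomm, Submodule.starProjection_apply_mem (fixedSubmodule U S) x w hw]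
  · rw [Submodule.mem_orthogonal]
    intro y hy
    have h1 : U v (U (-v) y) = y := by rw [← hadd, add_neg_cancel, hzero]
    have h2 : U (-v) y ∈ fixedSubmodule U S := by
      intro w hw
      rw [← hadd, add_comm, hadd, hy w hw]
    conv_lhs => rw [← hx v hv, ← map_sub, ← h1, LinearIsometry.inner_map_map, hx v hv]
    rw [real_inner_comm]
    exact Submodule.starProjection_inner_eq_zero _ _ h2

lemma fixedSubmodule_le_of_subset_closure (hzero : ∀ x, U 0 x = x)
    (hadd : ∀ v w x, U (v + w) x = U v (U w x)) {S S' : Set G}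
    (h : S' ⊆ AddSubgroup.closure S) : fixedSubmodule U S ≤ fixedSubmodule U S' := by
  intro x hx v hv
  have hvS := h hv
  clear hv
  induction hvS using AddSubgroup.closure_induction with
  | mem w hw => exact hx w hw
  | zero => exact hzero x
  | add v w _ _ hv hw => rw [hadd, hw, hv]
  | neg v _ hv =>
    conv_lhs => rw [← hv]
    rw [← hadd, neg_add_cancel, hzero]

end HilbertSpace

section MomentCurve

/-- The integral moment curve `(1, n, n ^ 2, …)`. -/
def momentVec (d n : ℕ) : Fin d → ℤ := fun j => (n : ℤ) ^ (j : ℕ)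

lemma isPrimitiveVec_momentVec {d : ℕ} (hd : 1 ≤ d) (n : ℕ) :
    IsPrimitiveVec (momentVec d n) := by
  have h : Finset.univ.gcd (momentVec d n) ∣ 1 := by
    simpa [momentVec] using
      Finset.gcd_dvd (f := momentVec d n) (Finset.mem_univ (⟨0, hd⟩ : Fin d))
  have := Finset.normalize_gcd (s := Finset.univ) (f := momentVec d n)
  rw [IsPrimitiveVec, ← this]
  exact normalize_eq_one.2 (isUnit_of_dvd_one h)

/-- Any `d` of the first `N` points of the moment curve span a lattice containing a
common multiple of `ℤ ^ d`. -/
lemma exists_smul_mem_closure_momentVec (d N : ℕ) :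
    ∃ M : ℕ, 0 < M ∧ ∀ t ⊆ Finset.range N, t.card = d → ∀ w : Fin d → ℤ,
      (M : ℤ) • w ∈ AddSubgroup.closure (momentVec d '' (t : Set ℕ)) := by
  classical
  let D : Finset ℕ → ℤ := fun t => if h : t.card = d then
    (Matrix.vandermonde fun i => ((t.orderEmbOfFin h i : ℕ) : ℤ)).det else 1
  have hD : ∀ t, D t ≠ 0 := by
    intro t
    by_cases h : t.card = d
    · simp only [D, h, dif_pos]
      refine Matrix.det_vandermonde_ne_zero_iff.2 fun i j hij => ?_
      exact (t.orderEmbOfFin h).injective (by exact_mod_cast hij)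
    · simp [D, h]
  refine ⟨∏ t ∈ (Finset.range N).powerset, (D t).natAbs,
    Finset.prod_pos fun t _ => Int.natAbs_pos.2 (hD t), fun t ht hcard w => ?_⟩
  have hdvd : D t ∣ ((∏ t ∈ (Finset.range N).powerset, (D t).natAbs : ℕ) : ℤ) :=
    Int.natAbs_dvd.1 (Int.natCast_dvd_natCast.2
      (Finset.dvd_prod_of_mem _ (Finset.mem_powerset.2 ht)))
  obtain ⟨c, hc⟩ := hdvd
  set V := Matrix.vandermonde fun i => ((t.orderEmbOfFin hcard i : ℕ) : ℤ) with hV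
  have hDV : D t = V.det := by simp [D, hcard, hV]
  have hw : V.det • w = Matrix.vecMul (Matrix.vecMul w V.adjugate) V := by
    rw [Matrix.vecMul_vecMul, Matrix.adjugate_mul, Matrix.vecMul_smul, Matrix.vecMul_one]
  rw [hc, hDV, mul_comm, mul_smul, hw]
  refine AddSubgroup.zsmul_mem _ ?_ c
  rw [Matrix.vecMul_eq_sum]
  refine AddSubgroup.sum_mem _ fun i _ => AddSubgroup.zsmul_mem _ ?_ _
  exact AddSubgroup.subset_closure
    ⟨t.orderEmbOfFin hcard i, t.orderEmbOfFin_mem hcard i, rfl⟩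

end MomentCurve

section InvariantSets

variable {X : Type} [MeasurableSpace X] {μ : Measure X} {d : ℕ} {T : (Fin d → ℤ) → X → X}

/-- Measurable sets that are invariant, up to null sets, under the `kℤ^d`-action. -/
def IsInvariantSet (d k : ℕ) (T : (Fin d → ℤ) → X → X) (μ : Measure X) (C : Set X) : Prop :=
  MeasurableSet C ∧ ∀ v : Fin d → ℤ, T ((k : ℤ) • v) ⁻¹' C =ᵐ[μ] C

/-- Invariant sets of positive measure without nontrivial invariant subsets. -/
def IsInvariantAtom (d k : ℕ) (T : (Fin d → ℤ) → X → X) (μ : Measure X) (C : Set X) : Prop :=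
  IsInvariantSet d k T μ C ∧ 0 < μ.real C ∧
    ∀ B ⊆ C, IsInvariantSet d k T μ B → μ.real B = 0 ∨ μ.real (C \ B) = 0

lemma IsInvariantSet.inter {k : ℕ} {B C : Set X} (hB : IsInvariantSet d k T μ B)
    (hC : IsInvariantSet d k T μ C) : IsInvariantSet d k T μ (B ∩ C) :=
  ⟨hB.1.inter hC.1, fun v => (hB.2 v).inter (hC.2 v)⟩

lemma IsInvariantSet.diff {k : ℕ} {B C : Set X} (hB : IsInvariantSet d k T μ B)
    (hC : IsInvariantSet d k T μ C) : IsInvariantSet d k T μ (B \ C) :=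
  ⟨hB.1.diff hC.1, fun v => (hB.2 v).diff (hC.2 v)⟩

lemma IsInvariantSet.mul_right {k : ℕ} {C : Set X} (hC : IsInvariantSet d k T μ C) (M : ℕ) :
    IsInvariantSet d (k * M) T μ C :=
  ⟨hC.1, fun v => by
    have := hC.2 ((M : ℤ) • v)
    rwa [← mul_smul, ← Nat.cast_mul] at this⟩

variable [IsProbabilityMeasure μ]

lemma IsErgodicAction.one_le_pow_mul_measureReal (hT : IsErgodicAction d T μ) {k : ℕ}
    (hk : 0 < k) {C : Set X} (hC : IsInvariantSet d k T μ C) (hpos : 0 < μ.real C) :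
    1 ≤ (k : ℝ) ^ d * μ.real C := by
  obtain ⟨⟨-, hadd, hmp⟩, herg⟩ := hT
  let t : (Fin d → Fin k) → Fin d → ℤ := fun r j => ((r j : ℕ) : ℤ)
  set D : Set X := ⋃ r, T (t r) ⁻¹' C with hD
  have hDm : MeasurableSet D := MeasurableSet.iUnion fun r => (hmp _).measurable hC.1
  have hle : ∀ v, (T v ⁻¹' D : Set X) ≤ᵐ[μ] D := by
    intro v
    have hr : ∀ r, ∃ r', T v ⁻¹' (T (t r) ⁻¹' C) =ᵐ[μ] T (t r') ⁻¹' C := by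
      intro r
      have hk' : (0 : ℤ) < k := by exact_mod_cast hk
      refine ⟨fun j => ⟨((t r j + v j) % k).toNat, ?_⟩, ?_⟩
      · have h1 := Int.emod_lt_of_pos (t r j + v j) hk'
        have h2 := Int.emod_nonneg (t r j + v j) hk'.ne'
        omega
      · set r' : Fin d → Fin k := fun j => ⟨((t r j + v j) % k).toNat, _⟩
        have h : t r + v = (k : ℤ) • (fun j => (t r j + v j) / k) + t r' := by
          ext j
          have h2 := Int.emod_nonneg (t r j + v j) hk'.ne'
          simp only [Pi.add_apply, Pi.smul_apply, smul_eq_mul, t, r'] at h2 ⊢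
          rw [Int.toNat_of_nonneg h2, Int.mul_ediv_add_emod]
        rw [← Set.preimage_comp, ← hadd, h, hadd, Set.preimage_comp]
        exact (hmp _).quasiMeasurePreserving.preimage_ae_eq (hC.2 _)
    have hall : ∀ᵐ x ∂μ, ∀ r, x ∈ T v ⁻¹' (T (t r) ⁻¹' C) → x ∈ D := by
      rw [ae_all_iff]
      intro r
      obtain ⟨r', hr'⟩ := hr r
      filter_upwards [hr'.mem_iff] with x hx hxr
      exact Set.mem_iUnion.2 ⟨r', hx.1 hxr⟩
    filter_upwards [hall] with x hx hxD
    obtain ⟨r, hr⟩ := Set.mem_iUnion.1 (show T v x ∈ D from hxD)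
    exact hx r hr
  have hDinv : ∀ v, μ ((T v ⁻¹' D) ∆ D) = 0 := fun v =>
    measure_symmDiff_eq_zero_iff.2 <| ae_eq_of_ae_subset_of_measure_ge (hle v)
      ((hmp v).measure_preimage hDm.nullMeasurableSet).ge
      ((hmp v).measurable hDm).nullMeasurableSet (measure_ne_top _ _)
  have hr0 : μ.real C ≤ μ.real D := by
    have h1 : μ.real (T (t fun _ => ⟨0, hk⟩) ⁻¹' C) = μ.real C :=
      (hmp _).measureReal_preimage hC.1.nullMeasurableSet
    rw [← h1]
    exact measureReal_mono (Set.subset_iUnion (fun r => T (t r) ⁻¹' C) _)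
  have hD1 : μ.real D = 1 := by
    rcases herg D hDm hDinv with h | h
    · simp only [measureReal_def, h] at hr0 hpos
      simp at hr0
      linarith
    · simp [measureReal_def, h]
  calc 1 = μ.real D := hD1.symm
    _ ≤ ∑ r, μ.real (T (t r) ⁻¹' C) := measureReal_iUnion_fintype_le _
    _ = ∑ _r : Fin d → Fin k, μ.real C := Finset.sum_congr rfl fun r _ =>
        (hmp _).measureReal_preimage hC.1.nullMeasurableSet
    _ = (k : ℝ) ^ d * μ.real C := by simp

/-- Every invariant set contains an atom in which `A` has at least the same density. -/
lemma IsErgodicAction.exists_invariantAtom_subset (hT : IsErgodicAction d T μ) {k : ℕ}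
    (hk : 0 < k) {A : Set X} (ρ : ℝ) {C : Set X}
    (hC : IsInvariantSet d k T μ C) (hpos : 0 < μ.real C)
    (hρ : ρ * μ.real C ≤ μ.real (A ∩ C)) :
    ∃ C' ⊆ C, IsInvariantAtom d k T μ C' ∧ ρ * μ.real C' ≤ μ.real (A ∩ C') := by
  obtain ⟨n, hn⟩ := exists_nat_gt ((k : ℝ) ^ d * μ.real C)
  induction n generalizing C with
  | zero =>
    have := hT.one_le_pow_mul_measureReal hk hC hpos
    norm_num at hn
    linarith
  | succ n ih =>
    by_cases hatom : IsInvariantAtom d k T μ C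
    · exact ⟨C, subset_rfl, hatom, hρ⟩
    obtain ⟨B, hBC, hB, hB0, hB1⟩ : ∃ B ⊆ C, IsInvariantSet d k T μ B ∧
        μ.real B ≠ 0 ∧ μ.real (C \ B) ≠ 0 := by
      by_contra! h
      exact hatom ⟨hC, hpos, fun B hBC hB => or_iff_not_imp_left.2 (h B hBC hB)⟩
    have hB0' := lt_of_le_of_ne measureReal_nonneg hB0.symm
    have hB1' := lt_of_le_of_ne measureReal_nonneg hB1.symm
    have h0 := hT.one_le_pow_mul_measureReal hk hB hB0'
    have h1 := hT.one_le_pow_mul_measureReal hk (hC.diff hB) hB1'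
    have hsum : μ.real B + μ.real (C \ B) = μ.real C := by
      have := measureReal_inter_add_sdiff (μ := μ) (s := C) hB.1
      rwa [Set.inter_eq_self_of_subset_right hBC] at this
    have hsumA : μ.real (A ∩ B) + μ.real (A ∩ (C \ B)) = μ.real (A ∩ C) := by
      have := measureReal_inter_add_sdiff (μ := μ) (s := A ∩ C) hB.1
      rwa [Set.inter_assoc, Set.inter_eq_self_of_subset_right hBC, Set.inter_sdiff_assoc] at this
    rw [← hsum, mul_add] at hn
    push_cast at hn
    by_cases hρB : ρ * μ.real B ≤ μ.real (A ∩ B)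
    · obtain ⟨C', hC', h⟩ := ih hB hB0' hρB (by linarith)
      exact ⟨C', hC'.trans hBC, h⟩
    · obtain ⟨C', hC', h⟩ := ih (hC.diff hB) hB1' (by rw [← hsum] at hρ; linarith) (by linarith)
      exact ⟨C', hC'.trans Set.sdiff_subset, h⟩

/-- A density increment argument: up to replacing `k` by a bounded multiple, there is an atom
in which `A` has no density increment on any `kM`-invariant subset. -/
lemma IsErgodicAction.exists_invariantAtom_no_increment (hT : IsErgodicAction d T μ)
    {A : Set X} {M : ℕ} (hM : 0 < M) {η : ℝ} (hη : 0 ≤ η)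
    (n : ℕ) :
    ∀ {k : ℕ}, 0 < k → ∀ {ρ : ℝ}, 1 < ρ + n * η → ∀ {C : Set X}, IsInvariantSet d k T μ C →
      0 < μ.real C → ρ * μ.real C ≤ μ.real (A ∩ C) →
      ∃ k', 0 < k' ∧ k' ≤ k * M ^ n ∧ ∃ C', IsInvariantAtom d k' T μ C' ∧
        ρ * μ.real C' ≤ μ.real (A ∩ C') ∧
        ∀ B ⊆ C', IsInvariantSet d (k' * M) T μ B →
          μ.real (A ∩ B) ≤ (μ.real (A ∩ C') / μ.real C' + η) * μ.real B := by
  induction n with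
  | zero =>
    intro k _ ρ hρ C _ hpos hC
    have h1 : μ.real (A ∩ C) ≤ μ.real C := measureReal_mono Set.inter_subset_right
    simp only [Nat.cast_zero, zero_mul, add_zero] at hρ
    nlinarith
  | succ n ih =>
    intro k hk ρ hρ C hC hpos hCρ
    obtain ⟨C', -, hC', hC'ρ⟩ := hT.exists_invariantAtom_subset hk ρ hC hpos hCρ
    by_cases hinc : ∀ B ⊆ C', IsInvariantSet d (k * M) T μ B →
        μ.real (A ∩ B) ≤ (μ.real (A ∩ C') / μ.real C' + η) * μ.real B
    · exact ⟨k, hk, Nat.le_mul_of_pos_right _ (pow_pos hM _), C', hC', hC'ρ, hinc⟩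
    push Not at hinc
    obtain ⟨B, -, hB, hBA⟩ := hinc
    have hAB : μ.real (A ∩ B) ≤ μ.real B := measureReal_mono Set.inter_subset_right
    have hρ' : ρ ≤ μ.real (A ∩ C') / μ.real C' := (le_div_iff₀ hC'.2.1).2 hC'ρ
    have hBpos : 0 < μ.real B := by
      refine lt_of_le_of_ne measureReal_nonneg fun h => ?_
      rw [← h, mul_zero] at hBA
      linarith
    have hBρ : (ρ + η) * μ.real B ≤ μ.real (A ∩ B) := by nlinarith
    obtain ⟨k', hk', hle, C'', hC'', h1, h2⟩ :=
      ih (Nat.mul_pos hk hM) (by push_cast at hρ; linarith) hB hBpos hBρ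
    refine ⟨k', hk', hle.trans_eq (by ring), C'', hC'', ?_, h2⟩
    nlinarith [hC''.2.1]

lemma IsInvariantAtom.isErgodicComponent {k : ℕ} {C : Set X} (hC : IsInvariantAtom d k T μ C) :
    IsErgodicComponent d k T μ ((μ C)⁻¹ • μ.restrict C) := by
  have hpos : 0 < μ C := (ENNReal.toReal_pos_iff.1 hC.2.1).1
  refine ⟨C, hC.1.1, hpos, fun v => measure_symmDiff_eq_zero_iff.2 (hC.1.2 v), rfl, ?_⟩
  intro B hB hinv
  have hCinv : (μ C)⁻¹ ≠ 0 := ENNReal.inv_ne_zero.2 (measure_ne_top _ _)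
  have hBC : IsInvariantSet d k T μ (B ∩ C) := by
    refine ⟨hB.inter hC.1.1, fun v => ?_⟩
    have h := hinv v
    rw [Measure.smul_apply, smul_eq_mul, mul_eq_zero, or_iff_right hCinv,
      measure_symmDiff_eq_zero_iff] at h
    filter_upwards [ae_imp_of_ae_restrict h.mem_iff, (hC.1.2 v).mem_iff] with x hx hxC
    exact propext ⟨fun ⟨h1, h2⟩ => ⟨(hx (hxC.1 h2)).1 h1, hxC.1 h2⟩,
      fun ⟨h1, h2⟩ => ⟨(hx h2).2 h1, hxC.2 h2⟩⟩
  rcases hC.2.2 _ Set.inter_subset_right hBC with h | h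
  · left
    rw [measureReal_eq_zero_iff] at h
    simp [Measure.restrict_apply hB, h]
  · right
    rw [measureReal_eq_zero_iff] at h
    have h1 : μ (B ∩ C) = μ C := by
      have := measure_inter_add_sdiff (μ := μ) C (hB.inter hC.1.1)
      rwa [h, add_zero, Set.inter_eq_self_of_subset_right Set.inter_subset_right] at this
    rw [Measure.smul_apply, Measure.restrict_apply hB, h1, smul_eq_mul]
    exact ENNReal.inv_mul_cancel hpos.ne' (measure_ne_top _ _)

end InvariantSets

section Koopman

variable {X : Type} [MeasurableSpace X] {μ : Measure X} {d : ℕ} {T : (Fin d → ℤ) → X → X}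

open scoped InnerProductSpace

/-- The Koopman representation on `L²(μ)`. -/
noncomputable def IsMPAction.koopman (hT : IsMPAction d T μ) (v : Fin d → ℤ) :
    Lp ℝ 2 μ →ₗᵢ[ℝ] Lp ℝ 2 μ :=
  Lp.compMeasurePreservingₗᵢ ℝ (T v) (hT.2.2 v)

lemma IsMPAction.coeFn_koopman (hT : IsMPAction d T μ) (v : Fin d → ℤ) (f : Lp ℝ 2 μ) :
    hT.koopman v f =ᵐ[μ] f ∘ T v :=
  Lp.coeFn_compMeasurePreserving f (hT.2.2 v)

lemma IsMPAction.koopman_zero (hT : IsMPAction d T μ) (f : Lp ℝ 2 μ) :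
    hT.koopman 0 f = f := by
  refine Lp.ext ((hT.coeFn_koopman 0 f).trans ?_)
  rw [hT.1, Function.comp_id]

lemma IsMPAction.koopman_add (hT : IsMPAction d T μ) (v w : Fin d → ℤ) (f : Lp ℝ 2 μ) :
    hT.koopman (v + w) f = hT.koopman v (hT.koopman w f) := by
  refine Lp.ext ((hT.coeFn_koopman _ f).trans ?_)
  refine EventuallyEq.trans ?_ (hT.coeFn_koopman v _).symm
  rw [add_comm, hT.2.1, ← Function.comp_assoc]
  exact ((hT.2.2 v).quasiMeasurePreserving.ae_eq_comp (hT.coeFn_koopman w f)).symm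

variable [IsProbabilityMeasure μ]

lemma IsMPAction.koopman_indicatorConstLp (hT : IsMPAction d T μ) {v : Fin d → ℤ} {B : Set X}
    (hB : MeasurableSet B) (hinv : T v ⁻¹' B =ᵐ[μ] B) :
    hT.koopman v (indicatorConstLp 2 hB (measure_ne_top μ B) (1 : ℝ)) =
      indicatorConstLp 2 hB (measure_ne_top μ B) 1 := by
  refine Lp.ext ((hT.coeFn_koopman v _).trans ?_)
  refine ((hT.2.2 v).quasiMeasurePreserving.ae_eq_comp indicatorConstLp_coeFn).trans ?_
  refine EventuallyEq.trans ?_ indicatorConstLp_coeFn.symm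
  exact indicator_ae_eq_of_ae_eq_set (f := fun _ => (1 : ℝ)) hinv

/-- The density of `A` relative to `C`, centred at `ρ`, as an element of `L²(μ)`. -/
noncomputable def centredIndicator (μ : Measure X) [IsProbabilityMeasure μ] {A C : Set X}
    (hA : MeasurableSet A) (hC : MeasurableSet C) (ρ : ℝ) : Lp ℝ 2 μ :=
  indicatorConstLp 2 (hA.inter hC) (measure_ne_top μ _) 1 -
    ρ • indicatorConstLp 2 hC (measure_ne_top μ _) 1

lemma inner_indicatorConstLp_centredIndicator {A B C : Set X} (hA : MeasurableSet A)
    (hC : MeasurableSet C) (hB : MeasurableSet B) (hBC : B ⊆ C) (ρ : ℝ) :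
    ⟪indicatorConstLp 2 hB (measure_ne_top μ B) (1 : ℝ), centredIndicator μ hA hC ρ⟫_ℝ =
      μ.real (A ∩ B) - ρ * μ.real B := by
  have h : B ∩ (A ∩ C) = A ∩ B := by
    rw [Set.inter_left_comm, Set.inter_eq_self_of_subset_left hBC]
  rw [centredIndicator, inner_sub_right, inner_smul_right,
    L2.real_inner_indicatorConstLp_one_indicatorConstLp_one,
    L2.real_inner_indicatorConstLp_one_indicatorConstLp_one,
    Set.inter_eq_self_of_subset_left hBC, h]

lemma norm_sq_centredIndicator_le {A C : Set X} (hA : MeasurableSet A)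
    (hC : MeasurableSet C) {ρ : ℝ} (hρ : μ.real (A ∩ C) = ρ * μ.real C) :
    ‖centredIndicator μ hA hC ρ‖ ^ 2 ≤ μ.real C := by
  rw [← real_inner_self_eq_norm_sq]
  conv_lhs => enter [2]; rw [centredIndicator]
  rw [inner_sub_left, inner_smul_left,
    inner_indicatorConstLp_centredIndicator hA hC _ Set.inter_subset_right,
    inner_indicatorConstLp_centredIndicator hA hC _ subset_rfl, hρ, ← Set.inter_assoc,
    Set.inter_self, hρ]
  have h1 : μ.real (A ∩ C) ≤ μ.real C := measureReal_mono Set.inter_subset_right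
  simp only [sub_self, mul_zero, sub_zero]
  nlinarith [mul_nonneg (sq_nonneg ρ) (measureReal_nonneg (μ := μ) (s := C))]

/-- The projection of the centred indicator of `A` to the invariant vectors is small if `A`
has no density increment on invariant subsets. -/
lemma IsMPAction.norm_sq_starProjection_centredIndicator_le (hT : IsMPAction d T μ)
    {A C : Set X} (hA : MeasurableSet A) {k : ℕ} (hC : IsInvariantSet d k T μ C) {ρ η : ℝ}
    (hη : 0 ≤ η) (hρ : μ.real (A ∩ C) = ρ * μ.real C)
    (hinc : ∀ B ⊆ C, IsInvariantSet d k T μ B → μ.real (A ∩ B) ≤ (ρ + η) * μ.real B) :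
    ‖(fixedSubmodule hT.koopman (Set.range fun w : Fin d → ℤ => (k : ℤ) • w)).starProjection
      (centredIndicator μ hA hC.1 ρ)‖ ^ 2 ≤ η * μ.real C := by
  set K := fixedSubmodule hT.koopman (Set.range fun w : Fin d → ℤ => (k : ℤ) • w) with hK
  set f := centredIndicator μ hA hC.1 ρ with hf
  set h := K.starProjection f with hh
  have hhK : h ∈ K := K.starProjection_apply_mem f
  have hint : Integrable h μ := (Lp.memLp h).integrable one_le_two
  have hset : ∀ B (hB : IsInvariantSet d k T μ B), B ⊆ C →
      ∫ x in B, h x ∂μ = μ.real (A ∩ B) - ρ * μ.real B := by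
    intro B hB hBC
    have hBK : indicatorConstLp 2 hB.1 (measure_ne_top μ B) (1 : ℝ) ∈ K := by
      rintro _ ⟨w, rfl⟩
      exact hT.koopman_indicatorConstLp hB.1 (hB.2 w)
    rw [← L2.inner_indicatorConstLp_one (𝕜 := ℝ) hB.1 (measure_ne_top μ B),
      ← inner_indicatorConstLp_centredIndicator hA hC.1 hB.1 hBC, hh,
      ← Submodule.inner_starProjection_left_eq_right, K.starProjection_eq_self_iff.2 hBK]
  have hlevel : IsInvariantSet d k T μ {x | η < h x} := by
    refine ⟨measurableSet_lt measurable_const (Lp.stronglyMeasurable h).measurable, fun v => ?_⟩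
    have h1 := hT.coeFn_koopman ((k : ℤ) • v) h
    rw [hhK _ ⟨v, rfl⟩] at h1
    filter_upwards [h1] with x hx
    change (η < h (T ((k : ℤ) • v) x)) = (η < h x)
    rw [hx, Function.comp_apply]
  have hle : ∀ᵐ x ∂μ.restrict C, h x ≤ η := by
    have hzero : μ.restrict C {x | η < h x} = 0 := by
      by_contra hne
      have h1 := setIntegral_gt_gt (μ := μ.restrict C) hη hint.restrict.integrableOn hne
      rw [measureReal_def, Measure.restrict_apply hlevel.1, ← measureReal_def,
        Measure.restrict_restrict hlevel.1,
        hset _ (hlevel.inter hC) Set.inter_subset_right] at h1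
      have h2 := hinc _ Set.inter_subset_right (hlevel.inter hC)
      linarith
    rw [ae_iff]
    simpa using hzero
  have hnorm : ‖h‖ ^ 2 = ∫ x in A ∩ C, h x ∂μ := by
    rw [← real_inner_self_eq_norm_sq]
    conv_lhs => enter [2]; rw [hh]
    rw [Submodule.inner_starProjection_left_eq_right, K.starProjection_eq_self_iff.2 hhK, hf,
      centredIndicator, inner_sub_left, inner_smul_left,
      L2.inner_indicatorConstLp_one, L2.inner_indicatorConstLp_one, hset C hC subset_rfl, hρ]
    simp
  rw [hnorm]
  calc ∫ x in A ∩ C, h x ∂μ ≤ ∫ x in A ∩ C, η ∂μ := by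
        refine integral_mono_ae hint.integrableOn (integrable_const _) ?_
        exact ae_restrict_of_ae_restrict_of_subset Set.inter_subset_right hle
    _ = μ.real (A ∩ C) * η := by simp
    _ ≤ η * μ.real C := by
        rw [mul_comm]
        exact mul_le_mul_of_nonneg_left (measureReal_mono Set.inter_subset_right) hη

/-- One of the first `N` directions of the moment curve has the property that `k`-invariant
sets along it that avoid `A` are small inside `C`. -/
lemma IsMPAction.exists_momentVec_measureReal_le (hT : IsMPAction d T μ) {A C : Set X}
    (hA : MeasurableSet A) {k M N : ℕ} (hd : 1 ≤ d) (hN : 0 < N)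
    (hM : ∀ t ⊆ Finset.range N, t.card = d → ∀ w : Fin d → ℤ,
      (M : ℤ) • w ∈ AddSubgroup.closure (momentVec d '' (t : Set ℕ)))
    (hC : IsInvariantSet d k T μ C) {ρ η : ℝ} (hη : 0 ≤ η)
    (hρ : μ.real (A ∩ C) = ρ * μ.real C)
    (hinc : ∀ B ⊆ C, IsInvariantSet d (k * M) T μ B → μ.real (A ∩ B) ≤ (ρ + η) * μ.real B) :
    ∃ n, ∀ B ⊆ C, MeasurableSet B → Disjoint A B →
      T ((k : ℤ) • momentVec d n) ⁻¹' B =ᵐ[μ] B →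
      ρ ^ 2 * μ.real B ≤ 2 * (d / N + η) * μ.real C := by
  set f := centredIndicator μ hA hC.1 ρ with hf
  set K : ℕ → Submodule ℝ (Lp ℝ 2 μ) := fun n =>
    fixedSubmodule hT.koopman {(k : ℤ) • momentVec d n} with hK
  set K' := fixedSubmodule hT.koopman (Set.range fun w : Fin d → ℤ => ((k * M : ℕ) : ℤ) • w)
    with hK'
  have hQ : ‖K'.starProjection f‖ ^ 2 ≤ η * μ.real C :=
    hT.norm_sq_starProjection_centredIndicator_le hA (hC.mul_right M) hη hρ hinc
  set g := f - K'.starProjection f with hg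
  have hgf : ‖g‖ ^ 2 ≤ μ.real C := by
    have h1 : ⟪K'.starProjection f, g⟫_ℝ = 0 := by
      rw [real_inner_comm]
      exact K'.starProjection_inner_eq_zero f _ (K'.starProjection_apply_mem f)
    have h2 : ‖f‖ ^ 2 = ‖K'.starProjection f‖ ^ 2 + ‖g‖ ^ 2 := by
      have h3 : f = K'.starProjection f + g := by rw [hg, add_sub_cancel]
      conv_lhs => rw [h3]
      rw [norm_add_sq_real, h1]; ring
    have h4 := norm_sq_centredIndicator_le hA hC.1 hρ
    nlinarith [sq_nonneg ‖K'.starProjection f‖]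
  have hsum : ∑ n ∈ Finset.range N, ‖(K n).starProjection g‖ ^ 2 ≤ (d - 1 : ℕ) * ‖g‖ ^ 2 := by
    refine sum_norm_sq_starProjection_le K
      (fun i j x hx => starProjection_mem_fixedSubmodule hT.koopman_zero hT.koopman_add _ _ hx)
      _ _ _ fun t ht hcard x hx => ?_
    rw [Nat.sub_add_cancel hd] at hcard
    have hx1 : x ∈ fixedSubmodule hT.koopman
        ((fun n => (k : ℤ) • momentVec d n) '' (t : Set ℕ)) := by
      rintro _ ⟨n, hn, rfl⟩
      exact hx n hn _ rfl
    have hx2 : x ∈ K' := by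
      refine fixedSubmodule_le_of_subset_closure hT.koopman_zero hT.koopman_add ?_ hx1
      rintro _ ⟨w, rfl⟩
      have h1 := AddSubgroup.mem_map_of_mem
        (DistribSMul.toAddMonoidHom (Fin d → ℤ) (k : ℤ)) (hM t ht hcard w)
      rw [AddMonoidHom.map_closure, Set.image_image] at h1
      simpa [mul_smul] using h1
    rw [real_inner_comm]
    exact K'.starProjection_inner_eq_zero f x hx2
  obtain ⟨n, -, hn⟩ : ∃ n ∈ Finset.range N,
      ‖(K n).starProjection g‖ ^ 2 ≤ d / N * μ.real C := by
    refine Finset.exists_le_of_sum_le (by simpa using hN.ne') (hsum.trans ?_)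
    have h1 : ((d - 1 : ℕ) : ℝ) ≤ d := by exact_mod_cast Nat.sub_le d 1
    have hN' : (0 : ℝ) < N := by exact_mod_cast hN
    rw [Finset.sum_const, Finset.card_range, nsmul_eq_mul, ← mul_assoc,
      mul_div_cancel₀ _ hN'.ne']
    exact mul_le_mul h1 hgf (sq_nonneg _) (Nat.cast_nonneg _)
  have hPf : ‖(K n).starProjection f‖ ^ 2 ≤ 2 * (d / N + η) * μ.real C := by
    have h1 : (K n).starProjection f
        = (K n).starProjection g + (K n).starProjection (K'.starProjection f) := by
      rw [← map_add, hg, sub_add_cancel]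
    have h2 := (K n).norm_starProjection_apply_le (K'.starProjection f)
    have h3 := norm_add_le ((K n).starProjection g)
      ((K n).starProjection (K'.starProjection f))
    rw [← h1] at h3
    have h4 : ‖(K n).starProjection f‖ ^ 2
        ≤ (‖(K n).starProjection g‖ + ‖K'.starProjection f‖) ^ 2 := by
      gcongr
      exact h3.trans (by gcongr)
    nlinarith [sq_nonneg (‖(K n).starProjection g‖ - ‖K'.starProjection f‖)]
  refine ⟨n, fun B hBC hB hAB hinv => ?_⟩
  set b := indicatorConstLp 2 hB (measure_ne_top μ B) (1 : ℝ) with hb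
  have hbK : b ∈ K n := by
    rintro _ rfl
    exact hT.koopman_indicatorConstLp hB hinv
  have hinner : ⟪b, (K n).starProjection f⟫_ℝ = -(ρ * μ.real B) := by
    rw [← Submodule.inner_starProjection_left_eq_right, (K n).starProjection_eq_self_iff.2 hbK,
      hb, inner_indicatorConstLp_centredIndicator hA hC.1 hB hBC, hAB.inter_eq]
    simp
  have hbn : ‖b‖ ^ 2 = μ.real B := by
    rw [← real_inner_self_eq_norm_sq, hb,
      L2.real_inner_indicatorConstLp_one_indicatorConstLp_one, Set.inter_self]
  have hcs := abs_real_inner_le_norm b ((K n).starProjection f)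
  rw [hinner] at hcs
  have hsq : (ρ * μ.real B) ^ 2 ≤ μ.real B * (2 * (d / N + η) * μ.real C) := by
    rw [← hbn, ← neg_sq, ← sq_abs, hbn]
    refine (pow_le_pow_left₀ (abs_nonneg _) hcs 2).trans ?_
    rw [mul_pow, hbn]
    exact mul_le_mul_of_nonneg_left hPf measureReal_nonneg
  rcases (measureReal_nonneg (μ := μ) (s := B)).eq_or_lt with h0 | hpos
  · rw [← h0, mul_zero]
    exact (sq_nonneg _).trans hPf
  · refine le_of_mul_le_mul_left ?_ hpos
    linarith [hsq, mul_pow ρ (μ.real B) 2]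

end Koopman

/-- **Theorem A (Quantitative directional expansivity).** For every `d ≥ 1`, `δ > 0`, `ε > 0`
there is `k₀ = k₀(d, δ, ε)` such that for every ergodic measure-preserving `ℤ^d`-action `T`
on a probability space `(X, μ)` and every measurable `A` with `μ(A) ≥ δ`, there are a
positive `k ≤ k₀`, a `T^k`-ergodic component `ν` of `μ` with `ν(A) ≥ μ(A)`, and a primitive
vector `v ∈ ℤ^d` with `ν(⋃_{n ∈ ℤ} (T^{nv})⁻¹ A) > 1 - ε`. -/
theorem quantitative_directional_expansivity
    (d : ℕ) (hd : 1 ≤ d) (δ ε : ℝ) (hδ : 0 < δ) (hε : 0 < ε) :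
    ∃ k₀ : ℕ, 0 < k₀ ∧
      ∀ (X : Type) (_ : MeasurableSpace X) (μ : Measure X) (_ : IsProbabilityMeasure μ)
        (T : (Fin d → ℤ) → X → X), IsErgodicAction d T μ →
        ∀ A : Set X, MeasurableSet A → δ ≤ (μ A).toReal →
          ∃ k : ℕ, 0 < k ∧ k ≤ k₀ ∧
            ∃ ν : Measure X, IsErgodicComponent d k T μ ν ∧
              (μ A).toReal ≤ (ν A).toReal ∧
              ∃ v : Fin d → ℤ, IsPrimitiveVec v ∧
                1 - ε < (ν (⋃ n : ℤ, T (n • v) ⁻¹' A)).toReal := by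
  obtain ⟨N, hN⟩ := exists_nat_gt (d / (ε * δ ^ 2 / 8))
  have hη : 0 < ε * δ ^ 2 / 8 := by positivity
  set η := ε * δ ^ 2 / 8 with hηdef
  have hN0 : (0 : ℝ) < N := lt_of_le_of_lt (by positivity) hN
  have hdN : (d : ℝ) / N ≤ η := by
    rw [div_lt_iff₀ hη] at hN
    rw [div_le_iff₀ hN0]
    linarith
  obtain ⟨M, hM0, hM⟩ := exists_smul_mem_closure_momentVec d N
  obtain ⟨n, hn⟩ := exists_nat_gt (1 / η)
  rw [div_lt_iff₀ hη] at hn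
  refine ⟨M ^ n, pow_pos hM0 n, fun X _ μ _ T hT A hA hAδ => ?_⟩
  have huniv : IsInvariantSet d 1 T μ Set.univ :=
    ⟨MeasurableSet.univ, fun v => by rw [Set.preimage_univ]; exact ae_eq_refl _⟩
  have hρ0 : (0 : ℝ) ≤ μ.real A := measureReal_nonneg
  obtain ⟨k, hk, hkle, C, hC, hAC, hinc⟩ := hT.exists_invariantAtom_no_increment hM0 hη.le n
    (A := A) one_pos (ρ := μ.real A) (by linarith) huniv (by simp) (by simp)
  have hCpos := hC.2.1
  set ρ := μ.real (A ∩ C) / μ.real C with hρdef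
  have hρA : μ.real A ≤ ρ := (le_div_iff₀ hCpos).2 hAC
  have hν : ∀ S, MeasurableSet S →
      (((μ C)⁻¹ • μ.restrict C) S).toReal = μ.real (S ∩ C) / μ.real C := by
    intro S hS
    rw [Measure.smul_apply, Measure.restrict_apply hS, smul_eq_mul, ENNReal.toReal_mul,
      ENNReal.toReal_inv, div_eq_inv_mul]
    rfl
  obtain ⟨m, hm⟩ := hT.1.exists_momentVec_measureReal_le hA hd (by exact_mod_cast hN0) hM hC.1
    hη.le (div_mul_cancel₀ _ hCpos.ne').symm hinc
  refine ⟨k, hk, by simpa using hkle, _, hC.isErgodicComponent, ?_,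
    momentVec d m, isPrimitiveVec_momentVec hd m, ?_⟩
  · rw [hν A hA]
    exact hρA
  set E : Set X := ⋃ n : ℤ, T (n • momentVec d m) ⁻¹' A with hE
  have hEm : MeasurableSet E := MeasurableSet.iUnion fun n => (hT.1.2.2 _).measurable hA
  have hEinv : ∀ j : ℤ, T (j • momentVec d m) ⁻¹' E = E := by
    intro j
    ext x
    simp only [hE, Set.mem_preimage, Set.mem_iUnion]
    have hadd : ∀ i : ℤ, T (i • momentVec d m) (T (j • momentVec d m) x)
        = T ((i + j) • momentVec d m) x := fun i => by rw [add_smul, hT.1.2.1]; rfl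
    simp only [hadd]
    exact ⟨fun ⟨i, hi⟩ => ⟨i + j, hi⟩, fun ⟨i, hi⟩ => ⟨i - j, by rwa [sub_add_cancel]⟩⟩
  have hAE : A ⊆ E := by
    intro x hx
    refine Set.mem_iUnion.2 ⟨0, ?_⟩
    rwa [zero_smul, hT.1.1]
  have hB := hm (C \ E) Set.sdiff_subset (hC.1.1.diff hEm)
    (Set.disjoint_sdiff_right.mono_left hAE) (by
      have h1 := hC.1.2 (momentVec d m)
      rw [Set.preimage_sdiff, hEinv]
      exact h1.diff (ae_eq_refl E))
  have hsplit : μ.real (E ∩ C) + μ.real (C \ E) = μ.real C := by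
    rw [Set.inter_comm]
    exact measureReal_inter_add_sdiff hEm
  rw [hν E hEm, lt_div_iff₀ hCpos]
  have hδρ : δ ^ 2 ≤ ρ ^ 2 := pow_le_pow_left₀ hδ.le (hAδ.trans hρA) 2
  have hfin : δ ^ 2 * μ.real (C \ E) ≤ δ ^ 2 * (ε / 2 * μ.real C) := by
    calc δ ^ 2 * μ.real (C \ E) ≤ ρ ^ 2 * μ.real (C \ E) := by gcongr
      _ ≤ 2 * (d / N + η) * μ.real C := hB
      _ ≤ 2 * (η + η) * μ.real C := by gcongr
      _ = δ ^ 2 * (ε / 2 * μ.real C) := by rw [hηdef]; ring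
  have hfin' := le_of_mul_le_mul_left hfin (by positivity)
  nlinarith
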